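/- arXiv:1603.07168 — 4 statements merged into one kernel-verified Lean document; each statement's English description precedes it below -/
import Mathlib

section
/- Let G = (A ∪ B, E) be as above and suppose the matching M together with the partition ⟨P1,P2,P3⟩ of B is well-structured; label every edge of E \ M with the applicant's vote. Then: every edge joining an applicant matched into P1 with a post in P2 is labeled −1; every edge joining an applicant matched into P2 with a post in P3 is labeled −1; there is no edge of G joining an applicant matched into P1 with a post in P3; and every edge labeled +1 joins either an applicant that is matched into P2 or unmatched with a post in P1, or an applicant matched into P3 with a post in P1 ∪ P2. -/
open Classical

noncomputable section

variable {A B : Type*}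

/-- A matching in the bipartite graph `G = (A ∪ B, E)`, represented as a partial
function assigning to each applicant `a ∈ A` its partner post (if any). -/
def IsMatching (E : A → B → Prop) (M : A → Option B) : Prop :=
  (∀ a b, M a = some b → E a b) ∧ ∀ a a' b, M a = some b → M a' = some b → a = a'

/-- Post `b` is matched in `M`. -/
def PostMatched (M : A → Option B) (b : B) : Prop := ∃ a, M a = some b

/-- Applicant `a` prefers matching `M` to `M'` (lower rank = more preferred);
an applicant prefers being matched to being unmatched. -/
def APrefers (rank : A → B → ℕ) (M M' : A → Option B) (a : A) : Prop :=
  match M a, M' a with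
  | some _, none => True
  | some b, some b' => rank a b < rank a b'
  | none, _ => False

/-- In the model where each post puts all its neighbors into a single tie,
post `b` prefers `M` to `M'` iff it is matched in `M` and unmatched in `M'`. -/
def BPrefers (M M' : A → Option B) (b : B) : Prop :=
  PostMatched M b ∧ ¬ PostMatched M' b

/-- `phi rank M M'` is the number of vertices preferring `M` to `M'`
(both sides vote; posts have all neighbors in a single tie). -/
def phi (rank : A → B → ℕ) (M M' : A → Option B) : ℕ :=
  Nat.card {a : A // APrefers rank M M' a} + Nat.card {b : B // BPrefers M M' b}

/-- `M` is a popular matching of `G` (two-sided votes, one-sided ties model). -/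
def Popular (E : A → B → Prop) (rank : A → B → ℕ) (M : A → Option B) : Prop :=
  IsMatching E M ∧ ∀ M', IsMatching E M' → phi rank M' M ≤ phi rank M M'

/-- The applicants' preference lists are strict: distinct neighbors get distinct ranks. -/
def StrictRanks (E : A → B → Prop) (rank : A → B → ℕ) : Prop :=
  ∀ a b b', E a b → E a b' → rank a b = rank a b' → b = b'

/-- `f a` is applicant `a`'s top-ranked neighbor. -/
def IsTopChoice (E : A → B → Prop) (rank : A → B → ℕ) (f : A → B) : Prop :=
  ∀ a, E a (f a) ∧ ∀ b, E a b → rank a (f a) ≤ rank a b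

/-- `rVal E rank F a` is the rank of `a`'s most preferred neighbor outside the
set `F` of top posts, and `⊤` (infinity) if all of `a`'s neighbors lie in `F`. -/
def rVal (E : A → B → Prop) (rank : A → B → ℕ) (F : Set B) (a : A) : ℕ∞ :=
  sInf {x : ℕ∞ | ∃ b, E a b ∧ b ∉ F ∧ x = (rank a b : ℕ∞)}

/-- A matching `M` together with a partition `⟨P1, P2, P3⟩` of the posts `B` is
well-structured. Here `Set.range f` is the set `F` of top posts. -/
structure WellStructured (E : A → B → Prop) (rank : A → B → ℕ) (f : A → B)
    (M : A → Option B) (P1 P2 P3 : Set B) : Prop where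
  union_eq : P1 ∪ P2 ∪ P3 = Set.univ
  disj12 : Disjoint P1 P2
  disj13 : Disjoint P1 P3
  disj23 : Disjoint P2 P3
  P1_subset_F : P1 ⊆ Set.range f
  P3_disjoint_F : Disjoint P3 (Set.range f)
  matched_P12 : ∀ b ∈ P1 ∪ P2, PostMatched M b
  unmatched_nbrs : ∀ a, M a = none → ∀ b, E a b → b ∈ P1
  pair_P1 : ∀ a b, M a = some b → b ∈ P1 → b = f a ∧ ∀ b', E a b' → b' ∉ P3
  pair_P2 : ∀ a b, M a = some b → b ∈ P2 →
    (∀ b', E a b' → b' ∈ P2 → rank a b ≤ rank a b') ∧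
      (rank a b : ℕ∞) ≤ rVal E rank (Set.range f) a
  pair_P3 : ∀ a b, M a = some b → b ∈ P3 →
    ∀ b', E a b' → b' ∈ P3 → rank a b ≤ rank a b'

/-- The label (the applicant's vote) of an edge `(a, b)` of `G` not belonging to the
matching `M`: it is `+1` if `a` is unmatched in `M` (equivalently, matched to its
dummy last-resort post in the `A`-complete extension `M̂`) or prefers `b` to `M a`,
and `-1` otherwise. -/
def edgeLabel (rank : A → B → ℕ) (M : A → Option B) (a : A) (b : B) : ℤ :=
  match M a with
  | none => 1
  | some b' => if rank a b < rank a b' then 1 else -1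

/-- An edge at a matched applicant is labeled `-1` iff its post is not preferred to the
applicant's partner. -/
theorem edgeLabel_eq_neg_one_iff {rank : A → B → ℕ} {M : A → Option B} {a : A} {b b' : B}
    (h : M a = some b') : edgeLabel rank M a b = -1 ↔ rank a b' ≤ rank a b := by
  unfold edgeLabel
  rw [h]
  dsimp only
  split_ifs with hlt
  · simpa using hlt
  · simpa using hlt

/-- An edge at a matched applicant is labeled `+1` iff its post is preferred to the
applicant's partner. -/
theorem edgeLabel_eq_one_iff {rank : A → B → ℕ} {M : A → Option B} {a : A} {b b' : B}
    (h : M a = some b') : edgeLabel rank M a b = 1 ↔ rank a b < rank a b' := by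
  unfold edgeLabel
  rw [h]
  dsimp only
  split_ifs with hlt
  · simpa using hlt
  · simpa using hlt

theorem rVal_le {E : A → B → Prop} {rank : A → B → ℕ} {F : Set B} {a : A} {b : B}
    (hE : E a b) (hF : b ∉ F) : rVal E rank F a ≤ rank a b :=
  sInf_le ⟨b, hE, hF, rfl⟩

namespace WellStructured

variable {E : A → B → Prop} {rank : A → B → ℕ} {f : A → B} {M : A → Option B}
  {P1 P2 P3 : Set B} {a : A} {b b' : B}

theorem rank_le_of_mem_P1 (hws : WellStructured E rank f M P1 P2 P3)
    (htop : IsTopChoice E rank f) (hm : M a = some b) (hb : b ∈ P1) (hE : E a b') :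
    rank a b ≤ rank a b' := by
  rw [(hws.pair_P1 a b hm hb).1]
  exact (htop a).2 b' hE

theorem rank_le_of_mem_P2_of_mem_P3 (hws : WellStructured E rank f M P1 P2 P3)
    (hm : M a = some b) (hb : b ∈ P2) (hE : E a b') (hb' : b' ∈ P3) :
    rank a b ≤ rank a b' :=
  ENat.natCast_le_natCast.mp <| (hws.pair_P2 a b hm hb).2.trans <|
    rVal_le hE (Set.disjoint_left.mp hws.P3_disjoint_F hb')

theorem mem_or_mem_or_mem (hws : WellStructured E rank f M P1 P2 P3) (b : B) :
    (b ∈ P1 ∨ b ∈ P2) ∨ b ∈ P3 := by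
  have h : b ∈ P1 ∪ P2 ∪ P3 := hws.union_eq ▸ Set.mem_univ b
  exact h

end WellStructured

/-- If `(M, ⟨P1, P2, P3⟩)` is well-structured and every edge of
`E \ M` is labeled with the applicant's vote, then: every edge from an applicant
matched into `P1` to a post of `P2` is labeled `-1`; every edge from an applicant
matched into `P2` to a post of `P3` is labeled `-1`; no edge joins an applicant
matched into `P1` with a post of `P3`; and every edge labeled `+1` joins either an
applicant matched into `P2` or unmatched with a post of `P1`, or an applicant
matched into `P3` with a post of `P1 ∪ P2`. -/
theorem edge_labels_of_wellStructured
    [Fintype A] [Fintype B]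
    (E : A → B → Prop) (rank : A → B → ℕ) (f : A → B)
    (hstrict : StrictRanks E rank) (htop : IsTopChoice E rank f)
    (M : A → Option B) (hM : IsMatching E M)
    (P1 P2 P3 : Set B) (hws : WellStructured E rank f M P1 P2 P3) :
    (∀ a b₁ b₂, M a = some b₁ → b₁ ∈ P1 → E a b₂ → b₂ ∈ P2 →
        edgeLabel rank M a b₂ = -1) ∧
    (∀ a b₂ b₃, M a = some b₂ → b₂ ∈ P2 → E a b₃ → b₃ ∈ P3 →
        edgeLabel rank M a b₃ = -1) ∧
    (∀ a b₁ b₃, M a = some b₁ → b₁ ∈ P1 → b₃ ∈ P3 → ¬ E a b₃) ∧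
    (∀ a b, E a b → M a ≠ some b → edgeLabel rank M a b = 1 →
        (b ∈ P1 ∧ (M a = none ∨ ∃ b', M a = some b' ∧ b' ∈ P2)) ∨
        (b ∈ P1 ∪ P2 ∧ ∃ b', M a = some b' ∧ b' ∈ P3)) := by
  refine ⟨fun a b₁ b₂ hm h₁ hE _ => ?_, fun a b₂ b₃ hm h₂ hE h₃ => ?_,
    fun a b₁ b₃ hm h₁ h₃ hE => (hws.pair_P1 a b₁ hm h₁).2 b₃ hE h₃, fun a b hE _ hlab => ?_⟩
  · exact (edgeLabel_eq_neg_one_iff hm).mpr (hws.rank_le_of_mem_P1 htop hm h₁ hE)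
  · exact (edgeLabel_eq_neg_one_iff hm).mpr (hws.rank_le_of_mem_P2_of_mem_P3 hm h₂ hE h₃)
  · rcases hm : M a with _ | b'
    · exact Or.inl ⟨hws.unmatched_nbrs a hm b hE, Or.inl rfl⟩
    · have hlt := (edgeLabel_eq_one_iff hm).mp hlab
      rcases hws.mem_or_mem_or_mem b' with (hb' | hb') | hb'
      · exact absurd (hws.rank_le_of_mem_P1 htop hm hb' hE) hlt.not_ge
      · rcases hws.mem_or_mem_or_mem b with (hb | hb) | hb
        · exact Or.inl ⟨hb, Or.inr ⟨b', rfl, hb'⟩⟩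
        · exact absurd ((hws.pair_P2 a b' hm hb').1 b hE hb) hlt.not_ge
        · exact absurd (hws.rank_le_of_mem_P2_of_mem_P3 hm hb' hE hb) hlt.not_ge
      · rcases hws.mem_or_mem_or_mem b with hb | hb
        · exact Or.inr ⟨hb, b', rfl, hb'⟩
        · exact absurd (hws.pair_P3 a b' hm hb' b hE hb) hlt.not_ge
end
end

section
/- Let G = (A ∪ B, E) be as above, let (M, ⟨P1,P2,P3⟩) be well-structured, extend M to the A-complete matching M̂ using dummy last-resort posts, and label all non-M̂ edges with the applicants' votes. Then for every matching M' of G, in every alternating path of M̂ ⊕ M' the number of edges labeled +1 is at most two plus the number of edges labeled −1; moreover, if one endpoint of the path is a dummy last-resort post, then the number of edges labeled +1 is at most one plus the number of edges labeled −1. -/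
open Classical

noncomputable section

variable {A B : Type*}

/-- The labels of the non-`M̂` edges `(aseq (i+1), bseq i)` (`i = 0, …, m-1`) along an
alternating path of `M̂ ⊕ M'` whose `M̂`-edges are `(aseq i, bseq i)` (for `i < m`)
together with the final `M̂`-edge at `aseq m` (to a real post or to its dummy
last-resort post). -/
def pathLabels (rank : A → B → ℕ) (M : A → Option B) {m : ℕ}
    (aseq : Fin (m + 1) → A) (bseq : Fin m → B) : List ℤ :=
  List.ofFn fun i : Fin m => edgeLabel rank M (aseq i.succ) (bseq i)

/-- The potential of a partner in the `A`-complete extension: `2` on `P1`, `1` on `P2` (which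
contains the dummy posts, represented by `none`), and `0` on the remaining posts. -/
def postPotential (P1 P2 : Set B) : Option B → ℤ
  | none => 1
  | some b => if b ∈ P1 then 2 else if b ∈ P2 then 1 else 0

lemma postPotential_nonneg (P1 P2 : Set B) (o : Option B) : 0 ≤ postPotential P1 P2 o := by
  unfold postPotential
  split
  · norm_num
  · split_ifs <;> norm_num

lemma postPotential_le_two (P1 P2 : Set B) (o : Option B) : postPotential P1 P2 o ≤ 2 := by
  unfold postPotential
  split
  · norm_num
  · split_ifs <;> norm_num

lemma edgeLabel_eq_one_or_eq_neg_one (rank : A → B → ℕ) (M : A → Option B) (a : A) (b : B) :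
    edgeLabel rank M a b = 1 ∨ edgeLabel rank M a b = -1 := by
  unfold edgeLabel
  split
  · exact Or.inl rfl
  · split_ifs <;> simp

lemma rVal_le_rank {E : A → B → Prop} (rank : A → B → ℕ) {F : Set B} {a : A} {b : B}
    (hE : E a b) (hb : b ∉ F) : rVal E rank F a ≤ rank a b :=
  sInf_le ⟨b, hE, hb, rfl⟩

/-- A post outside `P1 ∪ P2` has potential `0`. -/
lemma WellStructured.postPotential_eq_zero_of_not_postMatched {E : A → B → Prop}
    {rank : A → B → ℕ} {f : A → B} {M : A → Option B} {P1 P2 P3 : Set B}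
    (hws : WellStructured E rank f M P1 P2 P3) {b : B} (hb : ¬ PostMatched M b) :
    postPotential P1 P2 (some b) = 0 := by
  have h1 : b ∉ P1 := fun h => hb (hws.matched_P12 b (Or.inl h))
  have h2 : b ∉ P2 := fun h => hb (hws.matched_P12 b (Or.inr h))
  simp [postPotential, h1, h2]

/-- The label of an edge is bounded by the drop of the potential along it. -/
lemma WellStructured.edgeLabel_le {E : A → B → Prop} {rank : A → B → ℕ} {f : A → B}
    {M : A → Option B} {P1 P2 P3 : Set B} (hws : WellStructured E rank f M P1 P2 P3)
    (htop : IsTopChoice E rank f) {a : A} {b : B} (hE : E a b) :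
    edgeLabel rank M a b ≤ postPotential P1 P2 (some b) - postPotential P1 P2 (M a) := by
  have mem_P3 : ∀ c, c ∉ P1 → c ∉ P2 → c ∈ P3 := fun c h1 h2 => by
    have hc : c ∈ P1 ∪ P2 ∪ P3 := hws.union_eq ▸ Set.mem_univ c
    rcases hc with (h | h) | h
    exacts [absurd h h1, absurd h h2, h]
  cases hMa : M a with
  | none =>
    have hb := hws.unmatched_nbrs a hMa b hE
    simp [edgeLabel, postPotential, hMa, hb]
  | some c =>
    have neg_of_le : rank a c ≤ rank a b → edgeLabel rank M a b = -1 := fun h => by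
      simp [edgeLabel, hMa, h]
    have le_one : edgeLabel rank M a b ≤ 1 := by
      rcases edgeLabel_eq_one_or_eq_neg_one rank M a b with h | h <;> rw [h]; norm_num
    by_cases hc1 : c ∈ P1
    · obtain ⟨rfl, hno⟩ := hws.pair_P1 a c hMa hc1
      rw [neg_of_le ((htop a).2 b hE)]
      have hb3 := hno b hE
      by_cases hb1 : b ∈ P1
      · simp [postPotential, hc1, hb1]
      · have hb2 : b ∈ P2 := by
          by_contra hb2
          exact hb3 (mem_P3 b hb1 hb2)
        simp [postPotential, hc1, hb1, hb2]
    · by_cases hc2 : c ∈ P2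
      · obtain ⟨hbest, hr⟩ := hws.pair_P2 a c hMa hc2
        by_cases hb1 : b ∈ P1
        · simpa [postPotential, hc1, hc2, hb1] using le_one
        · by_cases hb2 : b ∈ P2
          · rw [neg_of_le (hbest b hE hb2)]
            simp [postPotential, hc1, hc2, hb1, hb2]
          · have hbF := Set.disjoint_left.mp hws.P3_disjoint_F (mem_P3 b hb1 hb2)
            rw [neg_of_le (by exact_mod_cast hr.trans (rVal_le_rank rank hE hbF))]
            simp [postPotential, hc1, hc2, hb1, hb2]
      · by_cases hb1 : b ∈ P1
        · simp only [postPotential, hc1, hc2, hb1, if_true, if_false]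
          linarith
        · by_cases hb2 : b ∈ P2
          · simpa [postPotential, hc1, hc2, hb1, hb2] using le_one
          · rw [neg_of_le (hws.pair_P3 a c hMa (mem_P3 c hc1 hc2) b hE (mem_P3 b hb1 hb2))]
            simp [postPotential, hc1, hc2, hb1, hb2]

lemma count_one_sub_count_neg_one_eq_sum (l : List ℤ) (hl : ∀ x ∈ l, x = 1 ∨ x = -1) :
    (l.count 1 : ℤ) - l.count (-1) = l.sum := by
  induction l with
  | nil => simp
  | cons x l ih =>
    have ih := ih fun y hy => hl y (List.mem_cons_of_mem x hy)
    rcases hl x List.mem_cons_self with rfl | rfl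
    · simp
      linarith
    · simp
      linarith

lemma eq_one_or_eq_neg_one_of_mem_pathLabels {rank : A → B → ℕ} {M : A → Option B} {m : ℕ}
    {aseq : Fin (m + 1) → A} {bseq : Fin m → B} {x : ℤ} (hx : x ∈ pathLabels rank M aseq bseq) :
    x = 1 ∨ x = -1 := by
  obtain ⟨i, rfl⟩ := List.mem_ofFn.mp hx
  exact edgeLabel_eq_one_or_eq_neg_one rank M _ _

/-- The labels along an alternating path sum to at most the total drop of the potential. -/
lemma WellStructured.sum_pathLabels_le {E : A → B → Prop} {rank : A → B → ℕ} {f : A → B}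
    {M M' : A → Option B} {P1 P2 P3 : Set B} (hws : WellStructured E rank f M P1 P2 P3)
    (htop : IsTopChoice E rank f) (hM' : IsMatching E M') {m : ℕ}
    {aseq : Fin (m + 1) → A} {bseq : Fin m → B}
    (hpath : ∀ i : Fin m,
      M (aseq i.castSucc) = some (bseq i) ∧ M' (aseq i.succ) = some (bseq i)) :
    (pathLabels rank M aseq bseq).sum ≤
      postPotential P1 P2 (M (aseq 0)) - postPotential P1 P2 (M (aseq (Fin.last m))) := by
  let p : Fin (m + 1) → ℤ := fun i => postPotential P1 P2 (M (aseq i))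
  have hstep : (pathLabels rank M aseq bseq).sum ≤ ∑ i : Fin m, (p i.castSucc - p i.succ) := by
    rw [pathLabels, List.sum_ofFn]
    refine Finset.sum_le_sum fun i _ => ?_
    have h := hws.edgeLabel_le htop (hM'.1 _ _ (hpath i).2)
    rwa [← (hpath i).1] at h
  have htel := (Fin.sum_univ_succ p).symm.trans (Fin.sum_univ_castSucc p)
  rw [Finset.sum_sub_distrib] at hstep
  change _ ≤ p 0 - p (Fin.last m)
  linarith

/-- Let `(M, ⟨P1, P2, P3⟩)` be well-structured, let `M̂` be its
`A`-complete extension by dummy last-resort posts, and let `M'` be any matching of `G`.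
Alternating paths of `M̂ ⊕ M'` come in two shapes.
*Even paths*: `b0 - aseq 0 - bseq 0 - aseq 1 - ⋯ - aseq m - (M̂ (aseq m))`, where
`b0` is matched in `M'` but unmatched in `M̂`, and the final endpoint `M̂ (aseq m)`
is either the dummy post of `aseq m` (when `M (aseq m) = none`) or a real post
unmatched in `M'`.
*Odd paths*: the same without `b0`, the applicant endpoint `aseq 0` being unmatched
in `M'`. In both cases the number of edges labeled `+1` is at most two plus the
number of edges labeled `-1`; and if an endpoint is a dummy last-resort post, the
number of edges labeled `+1` is at most one plus the number of edges labeled `-1`. -/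
theorem alternating_path_labels
    [Fintype A] [Fintype B]
    (E : A → B → Prop) (rank : A → B → ℕ) (f : A → B)
    (hstrict : StrictRanks E rank) (htop : IsTopChoice E rank f)
    (M M' : A → Option B) (hM : IsMatching E M) (hM' : IsMatching E M')
    (P1 P2 P3 : Set B) (hws : WellStructured E rank f M P1 P2 P3) :
    (∀ (m : ℕ) (aseq : Fin (m + 1) → A) (bseq : Fin m → B) (b0 : B),
      Function.Injective aseq →
      (∀ i : Fin m, M (aseq i.castSucc) = some (bseq i) ∧ M' (aseq i.succ) = some (bseq i)) →
      M' (aseq 0) = some b0 →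
      ¬ PostMatched M b0 →
      (M (aseq (Fin.last m)) = none ∨
        ∃ bl, M (aseq (Fin.last m)) = some bl ∧ ¬ PostMatched M' bl) →
      ((edgeLabel rank M (aseq 0) b0 :: pathLabels rank M aseq bseq).count 1 ≤
          (edgeLabel rank M (aseq 0) b0 :: pathLabels rank M aseq bseq).count (-1) + 2 ∧
        (M (aseq (Fin.last m)) = none →
          (edgeLabel rank M (aseq 0) b0 :: pathLabels rank M aseq bseq).count 1 ≤
            (edgeLabel rank M (aseq 0) b0 :: pathLabels rank M aseq bseq).count (-1) + 1))) ∧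
    (∀ (m : ℕ) (aseq : Fin (m + 1) → A) (bseq : Fin m → B),
      Function.Injective aseq →
      (∀ i : Fin m, M (aseq i.castSucc) = some (bseq i) ∧ M' (aseq i.succ) = some (bseq i)) →
      M' (aseq 0) = none →
      (M (aseq (Fin.last m)) = none ∨
        ∃ bl, M (aseq (Fin.last m)) = some bl ∧ ¬ PostMatched M' bl) →
      ((pathLabels rank M aseq bseq).count 1 ≤ (pathLabels rank M aseq bseq).count (-1) + 2 ∧
        (M (aseq (Fin.last m)) = none →
          (pathLabels rank M aseq bseq).count 1 ≤
            (pathLabels rank M aseq bseq).count (-1) + 1))) := by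
  refine ⟨fun m aseq bseq b0 _ hpath hb0 hun _ => ?_, fun m aseq bseq _ hpath _ _ => ?_⟩
  · have hsum := hws.sum_pathLabels_le htop hM' hpath
    have hfirst := hws.edgeLabel_le htop (hM'.1 _ _ hb0)
    rw [hws.postPotential_eq_zero_of_not_postMatched hun] at hfirst
    have hend := postPotential_nonneg P1 P2 (M (aseq (Fin.last m)))
    have hcount := count_one_sub_count_neg_one_eq_sum
      (edgeLabel rank M (aseq 0) b0 :: pathLabels rank M aseq bseq) (List.forall_mem_cons.mpr
        ⟨edgeLabel_eq_one_or_eq_neg_one rank M _ _,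
          fun _ => eq_one_or_eq_neg_one_of_mem_pathLabels⟩)
    rw [List.sum_cons] at hcount
    exact ⟨by omega, fun _ => by omega⟩
  · have hsum := hws.sum_pathLabels_le htop hM' hpath
    have hstart := postPotential_le_two P1 P2 (M (aseq 0))
    have hend := postPotential_nonneg P1 P2 (M (aseq (Fin.last m)))
    have hcount := count_one_sub_count_neg_one_eq_sum (pathLabels rank M aseq bseq)
      fun _ => eq_one_or_eq_neg_one_of_mem_pathLabels
    refine ⟨by omega, fun hdummy => ?_⟩
    have hdummy_potential : postPotential P1 P2 (M (aseq (Fin.last m))) = 1 := by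
      simp [hdummy, postPotential]
    omega
end
end

section
/- Let G = (A ∪ B, E) be a bipartite graph where each applicant has a strict preference list and each post puts all its neighbors into a single tie, let M* be a popular matching of G, and label every edge of E \ M* with the applicant's vote. Then: (i) there is no alternating path with respect to M* in which three consecutive non-matching edges are all labeled +1; and (ii) there is no alternating path with respect to M* in which five consecutive non-matching edges carry the labels +1, +1, −1, +1, +1 in this order. -/
open Classical

noncomputable section

variable {A B : Type*}

/-- The matching obtained from `M` by switching to the edges `(α i, β i)`: an applicant off the
path whose post lies on the path becomes unmatched. -/
def switchAlong {n : ℕ} (M : A → Option B) (α : Fin n → A) (β : Fin n → B) (a : A) : Option B :=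
  if h : ∃ i, α i = a then some (β h.choose)
  else if ∃ i, M a = some (β i) then none
  else M a

section switchAlong

variable {n : ℕ} {E : A → B → Prop} {rank : A → B → ℕ} {M : A → Option B}

theorem switchAlong_apply {α : Fin n → A} (hα : Function.Injective α) (β : Fin n → B)
    (i : Fin n) : switchAlong M α β (α i) = some (β i) := by
  have h : ∃ j, α j = α i := ⟨i, rfl⟩
  rw [switchAlong, dif_pos h, hα h.choose_spec]

theorem switchAlong_of_notMem {α : Fin n → A} (β : Fin n → B) {a : A} (ha : ¬ ∃ i, α i = a) :
    switchAlong M α β a = if ∃ i, M a = some (β i) then none else M a := by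
  rw [switchAlong, dif_neg ha]

theorem isMatching_switchAlong (hM : IsMatching E M) {α : Fin n → A} {β : Fin n → B}
    (hα : Function.Injective α) (hβ : Function.Injective β) (hE : ∀ i, E (α i) (β i)) :
    IsMatching E (switchAlong M α β) := by
  constructor
  · intro a b hab
    by_cases ha : ∃ i, α i = a
    · obtain ⟨i, rfl⟩ := ha
      rw [switchAlong_apply hα] at hab
      cases hab
      exact hE i
    · rw [switchAlong_of_notMem β ha] at hab
      split_ifs at hab
      exact hM.1 a b hab
  · intro a a' b hab hab'
    by_cases ha : ∃ i, α i = a <;> by_cases ha' : ∃ i, α i = a'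
    · obtain ⟨i, rfl⟩ := ha
      obtain ⟨j, rfl⟩ := ha'
      rw [switchAlong_apply hα] at hab hab'
      rw [hβ (Option.some.inj (hab.trans hab'.symm))]
    · obtain ⟨i, rfl⟩ := ha
      rw [switchAlong_apply hα] at hab
      rw [switchAlong_of_notMem β ha'] at hab'
      split_ifs at hab' with h
      exact absurd ⟨i, hab'.trans hab.symm⟩ h
    · obtain ⟨j, rfl⟩ := ha'
      rw [switchAlong_apply hα] at hab'
      rw [switchAlong_of_notMem β ha] at hab
      split_ifs at hab with h
      exact absurd ⟨j, hab.trans hab'.symm⟩ h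
    · rw [switchAlong_of_notMem β ha] at hab
      rw [switchAlong_of_notMem β ha'] at hab'
      split_ifs at hab hab'
      exact hM.2 a a' b hab hab'

theorem aPrefers_of_edgeLabel_eq_one {M' : A → Option B} {a : A} {b : B}
    (hM' : M' a = some b) (h : edgeLabel rank M a b = 1) : APrefers rank M' M a := by
  unfold APrefers
  unfold edgeLabel at h
  rw [hM']
  cases hMa : M a with
  | none => trivial
  | some c =>
    rw [hMa] at h
    by_contra hlt
    simp only [] at h hlt
    rw [if_neg hlt] at h
    norm_num at h

theorem APrefers.asymm {M' : A → Option B} {a : A} (h : APrefers rank M M' a) :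
    ¬ APrefers rank M' M a := by
  unfold APrefers at *
  cases hM : M a <;> cases hM' : M' a <;> simp_all
  omega

/-- Along an alternating path with `n + 1` non-matching edges, at most `(n + 3) / 2` of them
are labeled `+1`: switching costs at most one vote at each remaining applicant and one vote at
each end of the path. -/
theorem two_mul_card_le_of_popular [Fintype A] [Fintype B] (hpop : Popular E rank M)
    {α : Fin (n + 1) → A} {β : Fin (n + 1) → B}
    (hα : Function.Injective α) (hβ : Function.Injective β)
    (hM : ∀ i : Fin n, M (α i.succ) = some (β i.castSucc))
    (hE : ∀ i, E (α i) (β i)) (S : Finset (Fin (n + 1)))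
    (hS : ∀ i ∈ S, edgeLabel rank M (α i) (β i) = 1) :
    2 * S.card ≤ n + 3 := by
  have hle := hpop.2 _ (isMatching_switchAlong hpop.1 hα hβ hE)
  set M' := switchAlong M α β with hM'
  have hpref : ∀ i ∈ S, APrefers rank M' M (α i) := fun i hi =>
    aPrefers_of_edgeLabel_eq_one (switchAlong_apply hα β i) (hS i hi)
  have hgain : S.card ≤ phi rank M' M := by
    have hsub : ((S.image α : Finset A) : Set A) ⊆ {a | APrefers rank M' M a} := by
      intro a ha
      obtain ⟨i, hi, rfl⟩ := Finset.mem_image.1 (Finset.mem_coe.1 ha)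
      exact hpref i hi
    have hcard := Set.ncard_le_ncard hsub (Set.toFinite _)
    rw [Set.ncard_coe_finset, Finset.card_image_of_injective _ hα] at hcard
    exact hcard.trans (Nat.le_add_right _ _)
  have hlossA : Nat.card {a // APrefers rank M M' a} ≤ Sᶜ.card + 1 := by
    have hsub : {a | APrefers rank M M' a} ⊆
        ((Sᶜ.image α : Finset A) : Set A) ∪ {a | M a = some (β (Fin.last n))} := by
      intro a ha
      by_cases hmem : ∃ i, α i = a
      · obtain ⟨i, rfl⟩ := hmem
        left
        refine Finset.mem_coe.2 (Finset.mem_image_of_mem α (Finset.mem_compl.2 fun hi => ?_))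
        exact APrefers.asymm ha (hpref i hi)
      · right
        have heq := switchAlong_of_notMem (M := M) β hmem
        split_ifs at heq with h
        · obtain ⟨i, hi⟩ := h
          induction i using Fin.lastCases with
          | last => exact hi
          | cast j => exact absurd ⟨j.succ, hpop.1.2 _ _ _ (hM j) hi⟩ hmem
        · have ha' : APrefers rank M M' a := ha
          have hswap : APrefers rank M' M a := by
            unfold APrefers at ha' ⊢
            rw [hM', heq] at ha' ⊢
            exact ha'
          exact absurd hswap ha'.asymm
    have hone : {a | M a = some (β (Fin.last n))}.ncard ≤ 1 :=
      (Set.ncard_le_one_iff (Set.toFinite _)).2 fun {a b} ha hb => hpop.1.2 a b _ ha hb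
    calc Nat.card {a // APrefers rank M M' a}
        ≤ _ := Set.ncard_le_ncard hsub (Set.toFinite _)
      _ ≤ _ := Set.ncard_union_le _ _
      _ ≤ _ := by
        rw [Set.ncard_coe_finset, Finset.card_image_of_injective _ hα]
        exact Nat.add_le_add_left hone _
  have hlossB : Nat.card {b // BPrefers M M' b} ≤ 1 := by
    have hsub : ∀ b, BPrefers M M' b → M (α 0) = some b := by
      rintro b ⟨⟨a, hab⟩, hb⟩
      have hne : ∀ i, β i ≠ b := fun i hi => hb ⟨α i, hi ▸ switchAlong_apply hα β i⟩
      by_cases hmem : ∃ i, α i = a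
      · obtain ⟨i, rfl⟩ := hmem
        induction i using Fin.cases with
        | zero => exact hab
        | succ j => exact absurd (Option.some.inj ((hM j).symm.trans hab)) (hne _)
      · refine absurd ⟨a, ?_⟩ hb
        rw [hM', switchAlong_of_notMem β hmem, if_neg, hab]
        rintro ⟨i, hi⟩
        exact hne i (Option.some.inj (hi.symm.trans hab))
    refine Finite.card_le_one_iff_subsingleton.2 ⟨fun b c => Subtype.ext ?_⟩
    exact Option.some.inj ((hsub b b.2).symm.trans (hsub c c.2))
  have hcompl := Finset.card_add_card_compl S
  rw [Fintype.card_fin] at hcompl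
  unfold phi at hle hgain
  omega

end switchAlong

/-- Let `M` be a popular matching, with every edge of `E \ M` labeled
by the applicant's vote. (i) There is no alternating path with respect to `M` whose three
consecutive non-matching edges are all labeled `+1`: such a path has the form
`α 0 - β 0 - α 1 - β 1 - α 2 - β 2` (up to reversal), with matching edges
`(α 1, β 0), (α 2, β 1) ∈ M` and non-matching edges `(α i, β i)` labeled `+1`.
(ii) There is no alternating path with respect to `M` whose five consecutive non-matching
edges carry the labels `+1, +1, -1, +1, +1` in this order: such a path has the form
`α 0 - β 0 - α 1 - β 1 - ⋯ - α 4 - β 4` (up to reversal), with matching edges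
`(α (i+1), β i) ∈ M` and non-matching edges `(α i, β i)` carrying these labels. -/
theorem no_forbidden_label_patterns
    [Fintype A] [Fintype B]
    (E : A → B → Prop) (rank : A → B → ℕ)
    (hstrict : StrictRanks E rank)
    (M : A → Option B) (hpop : Popular E rank M) :
    (¬ ∃ (α : Fin 3 → A) (β : Fin 3 → B),
        Function.Injective α ∧ Function.Injective β ∧
        (∀ i : Fin 2, M (α i.succ) = some (β i.castSucc)) ∧
        (∀ i : Fin 3, E (α i) (β i) ∧ M (α i) ≠ some (β i) ∧
          edgeLabel rank M (α i) (β i) = 1)) ∧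
    (¬ ∃ (α : Fin 5 → A) (β : Fin 5 → B),
        Function.Injective α ∧ Function.Injective β ∧
        (∀ i : Fin 4, M (α i.succ) = some (β i.castSucc)) ∧
        (∀ i : Fin 5, E (α i) (β i) ∧ M (α i) ≠ some (β i)) ∧
        edgeLabel rank M (α 0) (β 0) = 1 ∧
        edgeLabel rank M (α 1) (β 1) = 1 ∧
        edgeLabel rank M (α 2) (β 2) = -1 ∧
        edgeLabel rank M (α 3) (β 3) = 1 ∧
        edgeLabel rank M (α 4) (β 4) = 1) := by
  refine ⟨?_, ?_⟩
  · rintro ⟨α, β, hα, hβ, hM, h⟩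
    have := two_mul_card_le_of_popular hpop hα hβ hM (fun i => (h i).1) Finset.univ
      fun i _ => (h i).2.2
    simp at this
  · rintro ⟨α, β, hα, hβ, hM, h, h0, h1, -, h3, h4⟩
    have := two_mul_card_le_of_popular hpop hα hβ hM (fun i => (h i).1) {0, 1, 3, 4} (by
      simp [h0, h1, h3, h4])
    have hcard : ({0, 1, 3, 4} : Finset (Fin 5)).card = 4 := by decide
    omega
end
end

section
/- Let G = (A ∪ B, E) be a bipartite graph where each applicant has a strict preference list and each post puts all its neighbors into a single tie. For every popular matching M* of G there exists a partition ⟨L1,L2,L3⟩ of B such that (M*, ⟨L1,L2,L3⟩) is well-structured; in particular F ⊆ L1 ∪ L2, every post left unmatched by M* lies in L3, and no applicant matched by M* to a post of L1 has a neighbor in L3. -/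
open Classical

noncomputable section

variable {A B : Type*}

section Potential

variable {X : Type*}

/-- The weight of the first `n` steps of the walk `c`. -/
def walkWeight (W : X → X → ℤ) (c : ℕ → X) (n : ℕ) : ℤ :=
  ∑ k ∈ Finset.range n, W (c k) (c (k + 1))

/-- The first `n` steps of `c` are arcs of `R`. -/
def IsWalk (R : X → X → Prop) (c : ℕ → X) (n : ℕ) : Prop :=
  ∀ k < n, R (c k) (c (k + 1))

/-- Cutting a closed segment out of a walk. -/
lemma IsWalk.exists_cut {R : X → X → Prop} (W : X → X → ℤ) {c : ℕ → X} {i d m : ℕ}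
    (hc : IsWalk R c (i + d + m)) (h : c i = c (i + d)) :
    ∃ c', IsWalk R c' (i + m) ∧ c' 0 = c 0 ∧ c' (i + m) = c (i + d + m) ∧
      walkWeight W c (i + d + m) =
        walkWeight W c' (i + m) + walkWeight W (fun k => c (i + k)) d := by
  have low : ∀ k ≤ i, (if k ≤ i then c k else c (k + d)) = c k := fun k hk => if_pos hk
  have high : ∀ k, (if i + k ≤ i then c (i + k) else c (i + k + d)) = c (i + d + k) := by
    intro k
    rcases Nat.eq_zero_or_pos k with rfl | hk
    · simpa using h
    · rw [if_neg (by omega)]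
      congr 1
      omega
  refine ⟨fun k => if k ≤ i then c k else c (k + d), ?_, low 0 (Nat.zero_le _), high m, ?_⟩
  · intro k hk
    rcases lt_or_ge k i with hki | hki
    · simpa only [low k hki.le, low (k + 1) hki] using hc k (by omega)
    · obtain ⟨l, rfl⟩ := Nat.exists_eq_add_of_le hki
      have := hc (i + d + l) (by omega)
      simpa only [high l, add_assoc i l 1, high (l + 1), add_assoc (i + d) l 1] using this
  · have e₁ : ∑ k ∈ Finset.range i, W (if k ≤ i then c k else c (k + d))
        (if k + 1 ≤ i then c (k + 1) else c (k + 1 + d)) =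
        ∑ k ∈ Finset.range i, W (c k) (c (k + 1)) := by
      refine Finset.sum_congr rfl fun k hk => ?_
      have hk := Finset.mem_range.1 hk
      rw [low k hk.le, low (k + 1) hk]
    have e₂ : ∑ k ∈ Finset.range m, W (if i + k ≤ i then c (i + k) else c (i + k + d))
        (if i + k + 1 ≤ i then c (i + k + 1) else c (i + k + 1 + d)) =
        ∑ k ∈ Finset.range m, W (c (i + d + k)) (c (i + d + k + 1)) := by
      refine Finset.sum_congr rfl fun k _ => ?_
      rw [high k, add_assoc i k 1, high (k + 1)]
      rfl
    simp only [walkWeight, Finset.sum_range_add, e₁, e₂, ← add_assoc]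
    exact add_right_comm _ _ _

/-- If no permutation along arcs has positive weight, then neither has a closed walk. -/
lemma walkWeight_nonpos_of_closed [Fintype X] {R : X → X → Prop} {W : X → X → ℤ}
    (hR : ∀ x, R x x) (hW : ∀ x, W x x = 0)
    (h : ∀ σ : Equiv.Perm X, (∀ x, R x (σ x)) → ∑ x, W x (σ x) ≤ 0)
    (n : ℕ) (c : ℕ → X) (hc : IsWalk R c n) (hn : c 0 = c n) : walkWeight W c n ≤ 0 := by
  induction n using Nat.strong_induction_on generalizing c with
  | _ n ih =>
  by_cases hinj : ∀ i j, i < j → j < n → c i ≠ c j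
  · rcases n with _ | n
    · simp [walkWeight]
    let e : Fin (n + 1) ↪ X := ⟨fun k => c k, by
      intro i j hij
      rcases lt_trichotomy i j with hlt | heq | hlt
      · exact absurd hij (hinj _ _ hlt j.2)
      · exact heq
      · exact absurd hij.symm (hinj _ _ hlt i.2)⟩
    have hrot : ∀ k : Fin (n + 1), c (finRotate (n + 1) k) = c (k + 1) := by
      intro k
      rw [coe_finRotate]
      split_ifs with hk
      · simp [hk, hn]
      · rfl
    let σ := (finRotate (n + 1)).viaEmbedding e
    have hσ : ∀ k, σ (e k) = c (k + 1) := fun k => by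
      rw [Equiv.Perm.viaEmbedding_apply]
      exact hrot k
    have hσ' : ∀ x, x ∉ Set.range e → σ x = x := fun x hx =>
      Equiv.Perm.viaEmbedding_apply_of_notMem _ _ _ hx
    have hsum : ∑ x, W x (σ x) = walkWeight W c (n + 1) := by
      rw [walkWeight, Finset.sum_range]
      refine (Fintype.sum_of_injective e e.injective _ _ ?_ ?_).symm
      · intro x hx
        rw [hσ' x hx, hW]
      · intro k
        rw [hσ k]
        rfl
    rw [← hsum]
    refine h σ fun x => ?_
    by_cases hx : x ∈ Set.range e
    · obtain ⟨k, rfl⟩ := hx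
      rw [hσ k]
      exact hc k k.2
    · rw [hσ' x hx]
      exact hR x
  · push Not at hinj
    obtain ⟨i, j, hij, hjn, heq⟩ := hinj
    obtain ⟨d, rfl⟩ := Nat.exists_eq_add_of_le hij.le
    obtain ⟨m, rfl⟩ := Nat.exists_eq_add_of_le hjn.le
    obtain ⟨c', hc', h0, h1, hw⟩ := hc.exists_cut W heq
    have w₁ := ih (i + m) (by omega) c' hc' (by rw [h0, h1, hn])
    have w₂ := ih d (by omega) (fun k => c (i + k))
      (fun k hk => hc (i + k) (by omega)) (by simpa using heq)
    linarith

/-- If no permutation along arcs has positive weight, then the arc weights have a potential. -/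
lemma exists_potential [Fintype X] {R : X → X → Prop} {W : X → X → ℤ}
    (hR : ∀ x, R x x) (hW : ∀ x, W x x = 0)
    (h : ∀ σ : Equiv.Perm X, (∀ x, R x (σ x)) → ∑ x, W x (σ x) ≤ 0) :
    ∃ p : X → ℤ, ∀ x y, R x y → p x + W x y ≤ p y := by
  obtain ⟨K, hK0, hK⟩ : ∃ K : ℤ, 0 ≤ K ∧ ∀ x y, W x y ≤ K := by
    refine ⟨∑ z : X × X, |W z.1 z.2|, Finset.sum_nonneg fun _ _ => abs_nonneg _, fun x y => ?_⟩
    exact (le_abs_self _).trans (Finset.single_le_sum (f := fun z : X × X => |W z.1 z.2|)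
      (fun _ _ => abs_nonneg _) (Finset.mem_univ (x, y)))
  have bound : ∀ n c, IsWalk R c n → walkWeight W c n ≤ Fintype.card X * K := by
    intro n
    induction n using Nat.strong_induction_on with
    | _ n ih =>
    intro c hc
    rcases le_or_gt n (Fintype.card X) with hn | hn
    · calc walkWeight W c n ≤ ∑ _k ∈ Finset.range n, K := Finset.sum_le_sum fun _ _ => hK _ _
        _ = n * K := by simp
        _ ≤ Fintype.card X * K := by gcongr
    · obtain ⟨a, b, hne, hab⟩ := Fintype.exists_ne_map_eq_of_card_lt
        (fun k : Fin n => c k) (by simpa using hn)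
      obtain ⟨i, j, hij, hjn, heq⟩ : ∃ i j, i < j ∧ j < n ∧ c i = c j := by
        rcases lt_or_gt_of_ne hne with hlt | hlt
        · exact ⟨a, b, hlt, b.2, hab⟩
        · exact ⟨b, a, hlt, a.2, hab.symm⟩
      obtain ⟨d, rfl⟩ := Nat.exists_eq_add_of_le hij.le
      obtain ⟨m, rfl⟩ := Nat.exists_eq_add_of_le hjn.le
      obtain ⟨c', hc', -, -, hw⟩ := hc.exists_cut W heq
      have w₁ := ih (i + m) (by omega) c' hc'
      have w₂ := walkWeight_nonpos_of_closed hR hW h d (fun k => c (i + k))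
        (fun k hk => hc (i + k) (by omega)) (by simpa using heq)
      linarith
  let S : X → Set ℤ := fun y => {w | ∃ n c, IsWalk R c n ∧ c n = y ∧ walkWeight W c n = w}
  have hne : ∀ y, (S y).Nonempty := fun y =>
    ⟨_, 0, fun _ => y, fun k hk => absurd hk (Nat.not_lt_zero k), rfl, rfl⟩
  have hbdd : ∀ y, BddAbove (S y) := fun y => by
    refine ⟨Fintype.card X * K, ?_⟩
    rintro _ ⟨n, c, hc, -, rfl⟩
    exact bound n c hc
  refine ⟨fun y => sSup (S y), fun x y hxy => ?_⟩
  obtain ⟨n, c, hc, hx, hw⟩ := Int.csSup_mem (hne x) (hbdd x)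
  refine le_csSup (hbdd y) ⟨n + 1, fun k => if k ≤ n then c k else y, ?_, ?_, ?_⟩
  · intro k hk
    rcases Nat.lt_succ_iff_lt_or_eq.1 hk with hlt | rfl
    · simpa only [if_pos hlt.le, if_pos (Nat.succ_le_of_lt hlt)] using hc k hlt
    · simpa [hx] using hxy
  · simp
  · have : ∀ k ∈ Finset.range n, W (if k ≤ n then c k else y)
        (if k + 1 ≤ n then c (k + 1) else y) = W (c k) (c (k + 1)) := by
      intro k hk
      have hk := Finset.mem_range.1 hk
      rw [if_pos hk.le, if_pos (Nat.succ_le_of_lt hk)]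
    simp only [← hw]
    rw [walkWeight, walkWeight, Finset.sum_range_succ, Finset.sum_congr rfl this]
    simp [hx]

end Potential

section Completion

/-- The edges of the completed graph: every applicant `a` gets a last resort post `inr a`, every
post `b` gets a last resort applicant `inr b`, and last resorts are adjacent to each other. -/
def CompletedEdge (E : A → B → Prop) : A ⊕ B → B ⊕ A → Prop
  | .inl a, .inl b => E a b
  | .inl a, .inr a' => a = a'
  | .inr b, .inl b' => b = b'
  | .inr _, .inr _ => True

/-- The vote of applicant `a` for being assigned `o` rather than `M a`. -/
def applicantVote (rank : A → B → ℕ) (M : A → Option B) (a : A) (o : Option B) : ℤ :=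
  (if APrefers rank (fun _ => o) M a then 1 else 0) -
    if APrefers rank M (fun _ => o) a then 1 else 0

/-- The share of the left endpoint in the weight of an edge of the completed graph. -/
def leftVote (rank : A → B → ℕ) (M : A → Option B) : A ⊕ B → B ⊕ A → ℤ
  | .inl a, v => applicantVote rank M a v.getLeft?
  | .inr _, _ => 0

/-- The share of the right endpoint in the weight of an edge of the completed graph. -/
def rightVote (M : A → Option B) : A ⊕ B → B ⊕ A → ℤ
  | .inl _, .inl b => if PostMatched M b then 0 else 1
  | .inr _, .inl b => if PostMatched M b then -1 else 0
  | _, .inr _ => 0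

/-- The perfect matching of the completed graph that extends `M`. -/
def completion (M : A → Option B) : A ⊕ B → B ⊕ A
  | .inl a => (M a).elim (.inr a) .inl
  | .inr b => if h : PostMatched M b then .inr h.choose else .inl b

lemma completion_inl_some {M : A → Option B} {a : A} {b : B} (h : M a = some b) :
    completion M (.inl a) = .inl b := by simp [completion, h]

lemma completion_inl_none {M : A → Option B} {a : A} (h : M a = none) :
    completion M (.inl a) = .inr a := by simp [completion, h]

lemma completion_inr_of_not {M : A → Option B} {b : B} (h : ¬ PostMatched M b) :
    completion M (.inr b) = .inl b := by simp [completion, h]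

lemma exists_completion_inr {M : A → Option B} {b : B} (h : PostMatched M b) :
    ∃ a, M a = some b ∧ completion M (.inr b) = .inr a :=
  ⟨h.choose, h.choose_spec, by simp [completion, h]⟩

lemma completion_inr {E : A → B → Prop} {M : A → Option B} (hM : IsMatching E M) {a : A} {b : B}
    (h : M a = some b) : completion M (.inr b) = .inr a := by
  obtain ⟨a', ha', hc⟩ := exists_completion_inr ⟨a, h⟩
  rw [hc, hM.2 a a' b h ha']

lemma completion_injective {E : A → B → Prop} {M : A → Option B} (hM : IsMatching E M) :
    Function.Injective (completion M) := by
  have key : ∀ a b, completion M (.inl a) ≠ completion M (.inr b) := by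
    intro a b h
    by_cases hb : PostMatched M b
    · obtain ⟨a', ha', hc⟩ := exists_completion_inr hb
      rcases ha : M a with _ | b'
      · rw [completion_inl_none ha, hc] at h
        cases h
        simp [ha] at ha'
      · rw [completion_inl_some ha, hc] at h
        cases h
    · rcases ha : M a with _ | b'
      · rw [completion_inl_none ha, completion_inr_of_not hb] at h
        cases h
      · rw [completion_inl_some ha, completion_inr_of_not hb] at h
        cases h
        exact hb ⟨a, ha⟩
  rintro (a | b) (a' | b') h
  · rcases ha : M a with _ | b <;> rcases ha' : M a' with _ | b'
    · rw [completion_inl_none ha, completion_inl_none ha'] at h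
      cases h
      rfl
    · rw [completion_inl_none ha, completion_inl_some ha'] at h
      cases h
    · rw [completion_inl_some ha, completion_inl_none ha'] at h
      cases h
    · rw [completion_inl_some ha, completion_inl_some ha'] at h
      cases h
      rw [hM.2 a a' b ha ha']
  · exact absurd h (key a b')
  · exact absurd h.symm (key a' b)
  · by_cases hb : PostMatched M b <;> by_cases hb' : PostMatched M b'
    · obtain ⟨a, ha, hc⟩ := exists_completion_inr hb
      obtain ⟨a', ha', hc'⟩ := exists_completion_inr hb'
      rw [hc, hc'] at h
      cases h
      rw [ha] at ha'
      cases ha'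
      rfl
    · obtain ⟨a, ha, hc⟩ := exists_completion_inr hb
      rw [hc, completion_inr_of_not hb'] at h
      cases h
    · obtain ⟨a', ha', hc'⟩ := exists_completion_inr hb'
      rw [hc', completion_inr_of_not hb] at h
      cases h
    · rw [completion_inr_of_not hb, completion_inr_of_not hb'] at h
      cases h
      rfl

lemma completedEdge_completion {E : A → B → Prop} {M : A → Option B} (hM : IsMatching E M)
    (x : A ⊕ B) : CompletedEdge E x (completion M x) := by
  rcases x with a | b
  · rcases ha : M a with _ | b
    · simp [completion_inl_none ha, CompletedEdge]
    · simpa [completion_inl_some ha, CompletedEdge] using hM.1 a b ha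
  · by_cases hb : PostMatched M b
    · obtain ⟨a, -, hc⟩ := exists_completion_inr hb
      simp [hc, CompletedEdge]
    · simp [completion_inr_of_not hb, CompletedEdge]

lemma applicantVote_self (rank : A → B → ℕ) (M : A → Option B) (a : A) :
    applicantVote rank M a (M a) = 0 := by
  rcases ha : M a with _ | b <;> simp [applicantVote, APrefers, ha]

lemma leftVote_add_rightVote_completion (rank : A → B → ℕ) (M : A → Option B) (x : A ⊕ B) :
    leftVote rank M x (completion M x) + rightVote M x (completion M x) = 0 := by
  rcases x with a | b
  · have h0 := applicantVote_self rank M a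
    rcases ha : M a with _ | b
    · rw [ha] at h0
      simpa [completion_inl_none ha, leftVote, rightVote] using h0
    · rw [ha] at h0
      have hb : PostMatched M b := ⟨a, ha⟩
      simpa [completion_inl_some ha, leftVote, rightVote, hb] using h0
  · by_cases hb : PostMatched M b
    · obtain ⟨a, -, hc⟩ := exists_completion_inr hb
      simp [hc, leftVote, rightVote]
    · simp [completion_inr_of_not hb, leftVote, rightVote, hb]

lemma natCard_subtype_eq_sum {α : Type*} [Fintype α] (P : α → Prop) :
    (Nat.card {x // P x} : ℤ) = ∑ x, if P x then 1 else 0 := by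
  rw [Nat.card_eq_fintype_card, Fintype.card_subtype, Finset.card_filter]
  push_cast
  rfl

variable [Fintype A] [Fintype B]

/-- Perfect matchings of the completed graph have nonpositive weight against a popular matching. -/
lemma Popular.sum_votes_nonpos {E : A → B → Prop} {rank : A → B → ℕ} {M : A → Option B}
    (hpop : Popular E rank M) (N : A ⊕ B ≃ B ⊕ A) (hN : ∀ x, CompletedEdge E x (N x)) :
    ∑ x, (leftVote rank M x (N x) + rightVote M x (N x)) ≤ 0 := by
  let M' : A → Option B := fun a => (N (.inl a)).getLeft?
  have hM' : ∀ a b, M' a = some b ↔ N (.inl a) = .inl b := fun a b => Sum.getLeft?_eq_some_iff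
  have hmatch : IsMatching E M' := by
    refine ⟨fun a b h => ?_, fun a a' b h h' => ?_⟩
    · have := hN (.inl a)
      rw [(hM' a b).1 h] at this
      exact this
    · exact Sum.inl_injective (N.injective (((hM' a b).1 h).trans ((hM' a' b).1 h').symm))
  have hleft : ∑ x, leftVote rank M x (N x) =
      (Nat.card {a // APrefers rank M' M a} : ℤ) - Nat.card {a // APrefers rank M M' a} := by
    rw [Fintype.sum_sum_type, natCard_subtype_eq_sum, natCard_subtype_eq_sum,
      ← Finset.sum_sub_distrib]
    simp only [leftVote, Finset.sum_const_zero, add_zero]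
    rfl
  have hright : ∑ x, rightVote M x (N x) =
      (Nat.card {b // BPrefers M' M b} : ℤ) - Nat.card {b // BPrefers M M' b} := by
    rw [natCard_subtype_eq_sum, natCard_subtype_eq_sum, ← Finset.sum_sub_distrib,
      ← Equiv.sum_comp N.symm, Fintype.sum_sum_type]
    simp only [Equiv.apply_symm_apply]
    have hz : ∑ a : A, rightVote M (N.symm (.inr a)) (.inr a) = 0 :=
      Finset.sum_eq_zero fun a _ => by simp [rightVote]
    rw [hz, add_zero]
    refine Finset.sum_congr rfl fun b _ => ?_
    rcases hx : N.symm (.inl b) with a | b'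
    · have hb : PostMatched M' b := ⟨a, (hM' a b).2 ((Equiv.symm_apply_eq N).1 hx).symm⟩
      by_cases hb' : PostMatched M b <;> simp [rightVote, BPrefers, hb, hb']
    · have hb : ¬ PostMatched M' b := by
        rintro ⟨a, ha⟩
        have := ((Equiv.symm_apply_eq N).2 ((hM' a b).1 ha).symm).symm.trans hx
        cases this
      by_cases hb' : PostMatched M b <;> simp [rightVote, BPrefers, hb, hb']
  have := hpop.2 M' hmatch
  simp only [phi] at this
  rw [Finset.sum_add_distrib, hleft, hright]
  omega

/-- A dual certificate for the popularity of `M`. -/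
lemma Popular.exists_dual {E : A → B → Prop} {rank : A → B → ℕ} {M : A → Option B}
    (hpop : Popular E rank M) (hAB : Nonempty A → Nonempty B) :
    ∃ (α : A → ℤ) (β : B → ℤ),
      (∀ a b, M a = some b → α a = β b) ∧
      (∀ a, M a = none → 0 ≤ α a) ∧
      (∀ a b, M a = some b → α a ≤ 1) ∧
      (∀ b, PostMatched M b → -1 ≤ β b) ∧
      (∀ b, ¬ PostMatched M b → β b ≤ 0) ∧
      ∀ a b, E a b →
        α a + applicantVote rank M a (some b) + (if PostMatched M b then 0 else 1) ≤ β b := by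
  have hM := hpop.1
  let C : A ⊕ B ≃ B ⊕ A := Equiv.ofBijective (completion M)
    ((Fintype.bijective_iff_injective_and_card _).2
      ⟨completion_injective hM, by simp [add_comm]⟩)
  obtain ⟨p, hp⟩ := exists_potential (R := fun x y => CompletedEdge E x (C y))
    (W := fun x y => leftVote rank M x (C y) + rightVote M x (C y))
    (completedEdge_completion hM) (leftVote_add_rightVote_completion rank M)
    (fun σ hσ => hpop.sum_votes_nonpos (σ.trans C) hσ)
  let q : B ⊕ A → ℤ := fun v => p (C.symm v)
  have hq : ∀ x v, CompletedEdge E x v → p x + (leftVote rank M x v + rightVote M x v) ≤ q v := by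
    intro x v hxv
    simpa using hp x (C.symm v) (by simpa using hxv)
  have hC : ∀ x v, completion M x = v → q v = p x := by
    rintro x _ rfl
    exact congrArg p (C.symm_apply_apply x)
  obtain ⟨t, ht, ht'⟩ : ∃ t, (∀ b, p (.inr b) ≤ t) ∧ ∀ a, t ≤ q (.inr a) := by
    rcases isEmpty_or_nonempty B with hB | hB
    · exact ⟨0, fun b => (hB.false b).elim, fun a => (hB.false (hAB ⟨a⟩).some).elim⟩
    · obtain ⟨b₀, hb₀⟩ := Finite.exists_max fun b : B => p (.inr b)
      exact ⟨p (.inr b₀), hb₀, fun a => by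
        simpa [leftVote, rightVote] using hq (.inr b₀) (.inr a) trivial⟩
  have hnone : ∀ a b, M a = some b → applicantVote rank M a none = -1 := by
    intro a b hab
    simp [applicantVote, APrefers, hab]
  have hlevel : ∀ a b, M a = some b → p (.inr b) = t ∧ q (.inr a) = t := by
    intro a b hab
    have := hC (.inr b) _ (completion_inr hM hab)
    have := ht b
    have := ht' a
    omega
  refine ⟨fun a => p (.inl a) - t, fun b => q (.inl b) - t, ?_, ?_, ?_, ?_, ?_, ?_⟩
  · intro a b hab
    simp only [hC _ _ (completion_inl_some hab)]
  · intro a ha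
    have := hC _ _ (completion_inl_none ha)
    have := ht' a
    simp only
    omega
  · intro a b hab
    have h := hq (.inl a) (.inr a) rfl
    simp only [leftVote, rightVote, Sum.getLeft?_inr, hnone a b hab] at h
    have := hlevel a b hab
    simp only
    omega
  · rintro b ⟨a, hab⟩
    have h := hq (.inr b) (.inl b) rfl
    simp only [leftVote, rightVote, if_pos (show PostMatched M b from ⟨a, hab⟩)] at h
    have := hlevel a b hab
    simp only
    omega
  · intro b hb
    have := hC _ _ (completion_inr_of_not hb)
    have := ht b
    simp only
    omega
  · intro a b hab
    have h := hq (.inl a) (.inl b) hab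
    simp only [leftVote, rightVote, Sum.getLeft?_inl] at h
    simp only
    omega

end Completion

lemma applicantVote_of_none {rank : A → B → ℕ} {M : A → Option B} {a : A} (h : M a = none)
    (b : B) : applicantVote rank M a (some b) = 1 := by
  simp [applicantVote, APrefers, h]

lemma applicantVote_of_lt {rank : A → B → ℕ} {M : A → Option B} {a : A} {b b' : B}
    (h : M a = some b) (hlt : rank a b' < rank a b) : applicantVote rank M a (some b') = 1 := by
  simp [applicantVote, APrefers, h, hlt, hlt.le]

lemma neg_one_le_applicantVote (rank : A → B → ℕ) (M : A → Option B) (a : A) (o : Option B) :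
    -1 ≤ applicantVote rank M a o := by
  unfold applicantVote
  split_ifs <;> norm_num

/-- For every popular matching `M*` there is a partition
`⟨L1, L2, L3⟩` of `B` such that `(M*, ⟨L1, L2, L3⟩)` is well-structured; in particular
`F ⊆ L1 ∪ L2`, every post left unmatched by `M*` lies in `L3`, and no applicant
matched by `M*` to a post of `L1` has a neighbor in `L3`. -/
theorem exists_wellStructured_of_popular
    [Fintype A] [Fintype B]
    (E : A → B → Prop) (rank : A → B → ℕ) (f : A → B)
    (hstrict : StrictRanks E rank) (htop : IsTopChoice E rank f)
    (M : A → Option B) (hpop : Popular E rank M) :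
    ∃ L1 L2 L3 : Set B,
      WellStructured E rank f M L1 L2 L3 ∧
      Set.range f ⊆ L1 ∪ L2 ∧
      (∀ b, ¬ PostMatched M b → b ∈ L3) ∧
      (∀ a b, M a = some b → b ∈ L1 → ∀ b', E a b' → b' ∉ L3) := by
  have hM := hpop.1
  obtain ⟨α, β, heq, hnone, hle, hge, hun, hedge⟩ :=
    hpop.exists_dual fun ⟨a⟩ => ⟨f a⟩
  have hedgeM : ∀ a b, E a b → PostMatched M b →
      α a + applicantVote rank M a (some b) ≤ β b := fun a b hE hb => by
    simpa [hb] using hedge a b hE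
  have hedgeU : ∀ a b, E a b → ¬ PostMatched M b →
      α a + applicantVote rank M a (some b) + 1 ≤ 0 := fun a b hE hb => by
    have := hedge a b hE
    rw [if_neg hb] at this
    have := hun b hb
    omega
  have hβle : ∀ b, PostMatched M b → β b ≤ 1 := fun b ⟨a, ha⟩ => heq a b ha ▸ hle a b ha
  have hα : ∀ a, -1 ≤ α a := fun a => by
    rcases ha : M a with _ | b
    · have := hnone a ha
      omega
    · rw [heq a b ha]
      exact hge b ⟨a, ha⟩
  have hbetter : ∀ a b b', M a = some b → E a b' → rank a b' < rank a b →
      PostMatched M b' ∧ β b + 1 ≤ β b' := by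
    intro a b b' hab hE hlt
    have hv := applicantVote_of_lt hab hlt
    have hb' : PostMatched M b' := by
      by_contra hb'
      have := hedgeU a b' hE hb'
      have := hα a
      omega
    have := hedgeM a b' hE hb'
    have := heq a b hab
    exact ⟨hb', by omega⟩
  have hfree : ∀ a, M a = none → ∀ b, E a b → PostMatched M b ∧ β b = 1 := by
    intro a ha b hE
    have hv := applicantVote_of_none (rank := rank) ha b
    have h0 := hnone a ha
    have hb : PostMatched M b := by
      by_contra hb
      have := hedgeU a b hE hb
      omega
    have := hedgeM a b hE hb
    have := hβle b hb
    exact ⟨hb, by omega⟩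
  have hFmatched : ∀ a, PostMatched M (f a) := by
    intro a
    rcases ha : M a with _ | b
    · exact (hfree a ha _ (htop a).1).1
    · rcases ((htop a).2 b (hM.1 a b ha)).lt_or_eq with hlt | he
      · exact (hbetter a b _ ha (htop a).1 hlt).1
      · exact ⟨a, by rw [ha, hstrict a _ _ (htop a).1 (hM.1 a b ha) he]⟩
  have hL1 : ∀ a b, M a = some b → β b = 1 →
      b = f a ∧ ∀ b', E a b' → PostMatched M b' ∧ 0 ≤ β b' := by
    intro a b hab hb
    have hαa := heq a b hab
    refine ⟨?_, fun b' hE => ?_⟩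
    · rcases ((htop a).2 b (hM.1 a b hab)).lt_or_eq with hlt | he
      · obtain ⟨hm, h2⟩ := hbetter a b _ hab (htop a).1 hlt
        have := hβle _ hm
        omega
      · exact (hstrict a _ _ (htop a).1 (hM.1 a b hab) he).symm
    · have hv := neg_one_le_applicantVote rank M a (some b')
      have hb' : PostMatched M b' := by
        by_contra hb'
        have := hedgeU a b' hE hb'
        omega
      have := hedgeM a b' hE hb'
      exact ⟨hb', by omega⟩
  let P1 : Set B := {b | PostMatched M b ∧ β b = 1}
  let P2 : Set B := {b | PostMatched M b ∧ β b ≠ 1 ∧ (β b = 0 ∨ b ∈ Set.range f)}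
  let P3 : Set B := {b | b ∉ P1 ∧ b ∉ P2}
  have hP3 : ∀ a b, M a = some b → b ∈ P1 → ∀ b', E a b' → b' ∉ P3 := by
    rintro a b hab ⟨-, hb⟩ b' hE ⟨h1, h2⟩
    obtain ⟨hm, h0⟩ := (hL1 a b hab hb).2 b' hE
    have := hβle b' hm
    have hne : β b' ≠ 1 := fun h => h1 ⟨hm, h⟩
    exact h2 ⟨hm, hne, Or.inl (by omega)⟩
  have hP1F : P1 ⊆ Set.range f := by
    rintro b ⟨⟨a, hab⟩, hb⟩
    exact ⟨a, ((hL1 a b hab hb).1).symm⟩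
  have hF : Set.range f ⊆ P1 ∪ P2 := by
    rintro _ ⟨a, rfl⟩
    by_cases h : β (f a) = 1
    · exact Or.inl ⟨hFmatched a, h⟩
    · exact Or.inr ⟨hFmatched a, h, Or.inr ⟨a, rfl⟩⟩
  have hbetterP2 : ∀ a b, M a = some b → b ∈ P2 → ∀ b', E a b' → rank a b' < rank a b →
      b' ∈ P1 := by
    rintro a b hab ⟨hm, hne, hb⟩ b' hE hlt
    obtain ⟨hm', hb'⟩ := hbetter a b b' hab hE hlt
    have hle' := hβle b' hm'
    rcases hb with hb | ⟨a', rfl⟩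
    · exact ⟨hm', by omega⟩
    · have hne' : M a' ≠ some (f a') := by
        intro h
        rw [hM.2 a a' _ hab h] at hlt hE
        exact absurd ((htop a').2 b' hE) (not_le.2 hlt)
      have h0 : 0 ≤ β (f a') := by
        rcases ha' : M a' with _ | c
        · have := (hfree a' ha' _ (htop a').1).2
          omega
        · have hc := hM.1 a' c ha'
          rcases ((htop a').2 c hc).lt_or_eq with hlt' | he
          · have := (hbetter a' c _ ha' (htop a').1 hlt').2
            have := hge c ⟨a', ha'⟩
            omega
          · exact absurd (by rw [ha', hstrict a' _ _ (htop a').1 hc he]) hne'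
      exact ⟨hm', by omega⟩
  refine ⟨P1, P2, P3, ⟨?_, ?_, ?_, ?_, hP1F, ?_, ?_, ?_, ?_, ?_, ?_⟩, hF, ?_, hP3⟩
  · ext b
    by_cases h1 : b ∈ P1 <;> by_cases h2 : b ∈ P2 <;> simp [P3, h1, h2]
  · exact Set.disjoint_left.2 fun b h1 h2 => h2.2.1 h1.2
  · exact Set.disjoint_left.2 fun b h1 h3 => h3.1 h1
  · exact Set.disjoint_left.2 fun b h2 h3 => h3.2 h2
  · exact Set.disjoint_left.2 fun b h3 hb => (hF hb).elim h3.1 h3.2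
  · rintro b (hb | hb)
    · exact hb.1
    · exact hb.1
  · exact fun a ha b hE => hfree a ha b hE
  · exact fun a b hab hb => ⟨(hL1 a b hab hb.2).1, hP3 a b hab hb⟩
  · intro a b hab hb
    refine ⟨fun b' hE hb' => ?_, ?_⟩
    · by_contra hlt
      exact hb'.2.1 (hbetterP2 a b hab hb b' hE (not_le.1 hlt)).2
    · refine le_sInf ?_
      rintro _ ⟨b', hE, hb', rfl⟩
      by_contra hlt
      exact hb' (hP1F (hbetterP2 a b hab hb b' hE (by simpa using hlt)))
  · intro a b hab hb b' hE hb'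
    by_contra hlt
    obtain ⟨hm', h⟩ := hbetter a b b' hab hE (not_le.1 hlt)
    have := hge b ⟨a, hab⟩
    have := hβle b' hm'
    refine (show b' ∉ P1 ∪ P2 from fun h => h.elim hb'.1 hb'.2) ?_
    by_cases h1 : β b' = 1
    · exact Or.inl ⟨hm', h1⟩
    · exact Or.inr ⟨hm', h1, Or.inl (by omega)⟩
  · exact fun b hb => ⟨fun h => hb h.1, fun h => hb h.1⟩
end
end
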